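/- Consider a two-player extensive-form game (as in the model below) satisfying perfect recall, and let v ∈ 𝒱 be such that every coordinate of v lies in {0, 1}. Then for every relevant pair (σ₁, σ₂) ∈ Σ₁ ⇌ Σ₂, v[σ₁, σ₂] = v[σ₁, ∅] · v[∅, σ₂]. -/

import Mathlib

open scoped Classical

/-- The type of "sequences" of a player: `none` is the empty sequence `∅`, and
`some (I, a)` is the sequence consisting of information set `I` (a set of nodes)
together with action `a` at `I`. -/
abbrev SeqP := Option (Set (List ℕ) × ℕ)

/-- The type of (candidate) reduced-normal-form plans: partial functions from
information sets to actions, encoded with `Option`. -/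
abbrev PlanT := Set (List ℕ) → Option ℕ

/-- Two information sets (of the two players) are connected, `I ⇌ J`, if some node
of one is a prefix of some node of the other. -/
def Connected (I J : Set (List ℕ)) : Prop := ∃ u ∈ I, ∃ v ∈ J, u <+: v ∨ v <+: u

/-- A two-player extensive-form game.  Nodes are histories (finite lists of naturals),
`H` is the finite, prefix-closed set of nodes.  The two players are `0` and `1`
(as elements of `Fin 2`, embedded into `Fin 3` via `Fin.castSucc`), and an internal
node `u` with `owner u = 2` is a chance node.  `sim i` is the information-partition
equivalence relation of player `i` on the internal nodes owned by player `i`. -/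
structure EFG where
  H : Finset (List ℕ)
  root_mem : ([] : List ℕ) ∈ H
  prefix_closed : ∀ u v : List ℕ, u <+: v → v ∈ H → u ∈ H
  owner : List ℕ → Fin 3
  sim : Fin 2 → List ℕ → List ℕ → Prop
  sim_mem : ∀ i u v, sim i u v → (∃ a, u ++ [a] ∈ H) ∧ owner u = Fin.castSucc i
  sim_refl : ∀ i u, (∃ a, u ++ [a] ∈ H) → owner u = Fin.castSucc i → sim i u u
  sim_symm : ∀ i u v, sim i u v → sim i v u
  sim_trans : ∀ i u v w, sim i u v → sim i v w → sim i u w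
  sim_actions : ∀ i u v, sim i u v → ∀ a : ℕ, u ++ [a] ∈ H ↔ v ++ [a] ∈ H

namespace EFG

variable (G : EFG)

/-- A node is internal if it has at least one child in the tree. -/
def Internal (u : List ℕ) : Prop := ∃ a, u ++ [a] ∈ G.H

/-- The (finite) set of actions `A(u) = {a : u ++ [a] ∈ H}` available at node `u`. -/
noncomputable def actions (u : List ℕ) : Finset ℕ :=
  (G.H.finite_toSet.preimage (f := fun a : ℕ => u ++ [a])
    (fun a _ b _ hab => by simpa using hab)).toFinset

/-- `I` is an information set of player `i`: an equivalence class of `sim i`. -/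
def InfoSet (i : Fin 2) (I : Set (List ℕ)) : Prop :=
  ∃ u, G.sim i u u ∧ I = {v | G.sim i u v}

/-- `seqᵢ(u)`: the list (ordered by increasing length of the prefix `w`) of pairs
`(I, a)` such that `w ++ [a] ≼ u` for some internal node `w` owned by player `i`
whose information set is `I`. -/
noncomputable def playerSeq (i : Fin 2) (u : List ℕ) : List (Set (List ℕ) × ℕ) :=
  (List.range u.length).filterMap fun k =>
    if G.Internal (u.take k) ∧ G.owner (u.take k) = Fin.castSucc i then
      some ({v | G.sim i (u.take k) v}, u.getD k 0)
    else none

/-- Perfect recall: nodes in the same information set have the same player sequence. -/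
def PerfectRecall : Prop := ∀ i u v, G.sim i u v → G.playerSeq i u = G.playerSeq i v

/-- The parent sequence `σ(I)` of an information set `I` of player `i`: the last
element of `seqᵢ(u)` for `u ∈ I` (`none` encodes the empty sequence `∅`). -/
noncomputable def parentSeq (i : Fin 2) (I : Set (List ℕ)) : SeqP :=
  if h : ∃ u, u ∈ I then (G.playerSeq i h.choose).getLast? else none

/-- All chance moves are public: any two nodes in the same information set have
the same set of chance moves (pairs of a chance node and an action) on their paths. -/
def PublicChance : Prop :=
  ∀ i u v, G.sim i u v →
    {p : List ℕ × ℕ | G.Internal p.1 ∧ G.owner p.1 = 2 ∧ p.1 ++ [p.2] <+: u} =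
    {p : List ℕ × ℕ | G.Internal p.1 ∧ G.owner p.1 = 2 ∧ p.1 ++ [p.2] <+: v}

/-- Triangle-freeness of the game. -/
def TriangleFree : Prop :=
  ¬ ∃ I₁ I₂ J₁ J₂ : Set (List ℕ),
      G.InfoSet 0 I₁ ∧ G.InfoSet 0 I₂ ∧ G.InfoSet 1 J₁ ∧ G.InfoSet 1 J₂ ∧
      I₁ ≠ I₂ ∧ J₁ ≠ J₂ ∧
      G.parentSeq 0 I₁ = G.parentSeq 0 I₂ ∧ G.parentSeq 1 J₁ = G.parentSeq 1 J₂ ∧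
      Connected I₁ J₁ ∧ Connected I₂ J₂ ∧ Connected I₁ J₂

/-- `σ` is a member of `Σᵢ`, the set of sequences of player `i`. -/
def IsSeq (i : Fin 2) (σ : SeqP) : Prop :=
  σ = none ∨ ∃ I a, σ = some (I, a) ∧ G.InfoSet i I ∧ ∃ u ∈ I, u ++ [a] ∈ G.H

/-- `(σ₁, σ₂)` is a relevant sequence pair, `σ₁ ⇌ σ₂`. -/
def RelPair (σ₁ σ₂ : SeqP) : Prop :=
  G.IsSeq 0 σ₁ ∧ G.IsSeq 1 σ₂ ∧
    (σ₁ = none ∨ σ₂ = none ∨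
      ∃ I₁ a₁ I₂ a₂, σ₁ = some (I₁, a₁) ∧ σ₂ = some (I₂, a₂) ∧ Connected I₁ I₂)

/-- `σ₂ ∈ Σ₂` is relevant for the player-1 information set `I₁`. -/
def RelFor₁ (σ₂ : SeqP) (I₁ : Set (List ℕ)) : Prop :=
  σ₂ = none ∨ ∃ I₂ a₂, σ₂ = some (I₂, a₂) ∧ Connected I₁ I₂

/-- `σ₁ ∈ Σ₁` is relevant for the player-2 information set `I₂`. -/
def RelFor₂ (σ₁ : SeqP) (I₂ : Set (List ℕ)) : Prop :=
  σ₁ = none ∨ ∃ I₁ a₁, σ₁ = some (I₁, a₁) ∧ Connected I₁ I₂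

/-- The index set of correlation plans: the relevant sequence pairs `Σ₁ ⇌ Σ₂`. -/
abbrev Idx := {p : SeqP × SeqP // G.RelPair p.1 p.2}

/-- The entry of a vector `v` indexed by relevant pairs at the pair `(σ₁, σ₂)`
(and `0` at irrelevant pairs, which never occur in the constraints below). -/
noncomputable def val (v : G.Idx → ℝ) (σ₁ σ₂ : SeqP) : ℝ :=
  if h : G.RelPair σ₁ σ₂ then v ⟨(σ₁, σ₂), h⟩ else 0

/-- The von Stengel–Forges polytope `𝒱`. -/
def VSF : Set (G.Idx → ℝ) :=
  {v | (∀ p, 0 ≤ v p) ∧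
    G.val v none none = 1 ∧
    (∀ I₁, G.InfoSet 0 I₁ → ∀ σ₂, G.IsSeq 1 σ₂ → RelFor₁ σ₂ I₁ → ∀ u ∈ I₁,
      ∑ a ∈ G.actions u, G.val v (some (I₁, a)) σ₂ = G.val v (G.parentSeq 0 I₁) σ₂) ∧
    (∀ I₂, G.InfoSet 1 I₂ → ∀ σ₁, G.IsSeq 0 σ₁ → RelFor₂ σ₁ I₂ → ∀ u ∈ I₂,
      ∑ a ∈ G.actions u, G.val v σ₁ (some (I₂, a)) = G.val v σ₁ (G.parentSeq 1 I₂))}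

/-- `π` is a reduced-normal-form plan for player `i`. -/
def IsPlan (i : Fin 2) (π : PlanT) : Prop :=
  (∀ I, ¬ G.InfoSet i I → π I = none) ∧
  (∀ I, G.InfoSet i I →
    ((π I).isSome = true ↔ ∀ u ∈ I, ∀ p ∈ G.playerSeq i u, π p.1 = some p.2)) ∧
  (∀ I a, G.InfoSet i I → π I = some a → ∃ u ∈ I, u ++ [a] ∈ G.H)

/-- `Πᵢ(σ)`: the set of reduced-normal-form plans of player `i` compatible with `σ`. -/
def PlanSet (i : Fin 2) : SeqP → Set PlanT
  | none => {π | G.IsPlan i π}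
  | some (I, a) => {π | G.IsPlan i π ∧ π I = some a}

/-- `μ` is a probability distribution on `Π₁ × Π₂`. -/
def IsDist (μ : PlanT × PlanT → ℝ) : Prop :=
  (∀ q, 0 ≤ μ q) ∧ (Function.support μ).Finite ∧
  (∀ q, μ q ≠ 0 → G.IsPlan 0 q.1 ∧ G.IsPlan 1 q.2) ∧
  ∑ᶠ q, μ q = 1

/-- The linear map `f` from distributions on `Π₁ × Π₂` to correlation plans. -/
noncomputable def corrMap (μ : PlanT × PlanT → ℝ) : G.Idx → ℝ :=
  fun p => ∑ᶠ q ∈ {q : PlanT × PlanT | q.1 ∈ G.PlanSet 0 p.1.1 ∧ q.2 ∈ G.PlanSet 1 p.1.2}, μ q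

/-- The polytope of correlation plans `Ξ`: the image of the probability distributions
on `Π₁ × Π₂` under `f`. -/
def corrPoly : Set (G.Idx → ℝ) := {x | ∃ μ, G.IsDist μ ∧ x = G.corrMap μ}

/-- The `σ₁`-rank of a player-2 information set `I₂`: the number of player-1
information sets connected to `I₂` whose parent sequence is `σ₁`. -/
noncomputable def rank₁ (σ₁ : SeqP) (I₂ : Set (List ℕ)) : ℕ :=
  Nat.card {J : Set (List ℕ) // G.InfoSet 0 J ∧ Connected J I₂ ∧ G.parentSeq 0 J = σ₁}

/-- The `σ₂`-rank of a player-1 information set `I₁`: the number of player-2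
information sets connected to `I₁` whose parent sequence is `σ₂`. -/
noncomputable def rank₂ (σ₂ : SeqP) (I₁ : Set (List ℕ)) : ℕ :=
  Nat.card {J : Set (List ℕ) // G.InfoSet 1 J ∧ Connected I₁ J ∧ G.parentSeq 1 J = σ₂}

end EFG

/-- The point-mass distribution `𝟙_{q₀}` on pairs of plans. -/
noncomputable def pointMass (q₀ : PlanT × PlanT) : PlanT × PlanT → ℝ :=
  fun q => if q = q₀ then 1 else 0

namespace EFG

lemma mem_actions (G : EFG) {u : List ℕ} {a : ℕ} : a ∈ G.actions u ↔ u ++ [a] ∈ G.H := by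
  simp [actions]

lemma mem_playerSeq (G : EFG) {i : Fin 2} {u : List ℕ} {x : Set (List ℕ) × ℕ}
    (hu : u ∈ G.H) (hx : x ∈ G.playerSeq i u) :
    ∃ w a, w ++ [a] <+: u ∧ w ++ [a] ∈ G.H ∧ G.sim i w w ∧ x = ({v | G.sim i w v}, a) := by
  simp only [playerSeq, List.mem_filterMap, List.mem_range] at hx
  obtain ⟨k, hk, hx⟩ := hx
  split_ifs at hx with hc
  have htake : u.take k ++ [u.getD k 0] = u.take (k + 1) := by
    rw [List.getD_eq_getElem _ _ hk, List.take_append_getElem hk]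
  refine ⟨u.take k, u.getD k 0, ?_, ?_, G.sim_refl _ _ hc.1 hc.2, by simpa using hx.symm⟩
  · rw [htake]; exact List.take_prefix _ _
  · rw [htake]; exact G.prefix_closed _ _ (List.take_prefix _ _) hu

/-- Under perfect recall the parent sequence of the information set of `u` is either empty or
consists of the information set of a proper prefix `w` of `u` and the action taken there. -/
lemma parentSeq_eq_none_or (G : EFG) (hpr : G.PerfectRecall) {i : Fin 2} {u : List ℕ}
    (hu : G.sim i u u) :
    G.parentSeq i {v | G.sim i u v} = none ∨
      ∃ w a, w ++ [a] <+: u ∧ w ++ [a] ∈ G.H ∧ G.sim i w w ∧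
        G.parentSeq i {v | G.sim i u v} = some ({v | G.sim i w v}, a) := by
  have hne : ∃ v, v ∈ {v | G.sim i u v} := ⟨u, hu⟩
  have hpar : G.parentSeq i {v | G.sim i u v} = (G.playerSeq i u).getLast? := by
    rw [parentSeq, dif_pos hne, hpr i u _ hne.choose_spec]
  obtain ⟨⟨a, ha⟩, -⟩ := G.sim_mem _ _ _ hu
  have huH : u ∈ G.H := G.prefix_closed _ _ (List.prefix_append _ _) ha
  rw [hpar]
  cases hl : (G.playerSeq i u).getLast? with
  | none => exact Or.inl rfl
  | some x =>
    obtain ⟨w, b, h1, h2, h3, rfl⟩ := G.mem_playerSeq huH (List.mem_of_getLast? hl)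
    exact Or.inr ⟨w, b, h1, h2, h3, rfl⟩

lemma isSeq_some (G : EFG) {i : Fin 2} {u : List ℕ} {a : ℕ} (hu : G.sim i u u)
    (ha : u ++ [a] ∈ G.H) : G.IsSeq i (some ({v | G.sim i u v}, a)) :=
  Or.inr ⟨_, _, rfl, ⟨u, hu, rfl⟩, u, hu, ha⟩

lemma val_nonneg (G : EFG) {v : G.Idx → ℝ} (hv : ∀ p, 0 ≤ v p) (σ₁ σ₂ : SeqP) :
    0 ≤ G.val v σ₁ σ₂ := by
  unfold val
  split_ifs
  exacts [hv _, le_rfl]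

lemma val_eq_zero_or_one (G : EFG) {v : G.Idx → ℝ} (hv : ∀ p, v p = 0 ∨ v p = 1)
    (σ₁ σ₂ : SeqP) : G.val v σ₁ σ₂ = 0 ∨ G.val v σ₁ σ₂ = 1 := by
  unfold val
  split_ifs
  exacts [hv _, Or.inl rfl]

lemma val_mul_of_zero_one_of_comparable (G : EFG) (hpr : G.PerfectRecall) (v : G.Idx → ℝ)
    (hv : v ∈ G.VSF) (hint : ∀ p : G.Idx, v p = 0 ∨ v p = 1) (x y : List ℕ)
    (hx : G.sim 0 x x) (hy : G.sim 1 y y) (hxy : x <+: y ∨ y <+: x) (a b : ℕ)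
    (ha : x ++ [a] ∈ G.H) (hb : y ++ [b] ∈ G.H) :
    G.val v (some ({z | G.sim 0 x z}, a)) (some ({z | G.sim 1 y z}, b)) =
      G.val v (some ({z | G.sim 0 x z}, a)) none * G.val v none (some ({z | G.sim 1 y z}, b)) := by
  induction hn : x.length + y.length using Nat.strong_induction_on generalizing x y a b with
  | _ n ih =>
  subst hn
  have nonneg := G.val_nonneg hv.1
  have zero_one := G.val_eq_zero_or_one hint
  obtain ⟨-, hroot, hsum₁, hsum₂⟩ := hv
  have hconn : Connected {z | G.sim 0 x z} {z | G.sim 1 y z} := ⟨x, hx, y, hy, hxy⟩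
  have rec₁ : ∀ b', y ++ [b'] ∈ G.H →
      G.val v (G.parentSeq 0 {z | G.sim 0 x z}) (some ({z | G.sim 1 y z}, b')) =
        G.val v (G.parentSeq 0 {z | G.sim 0 x z}) none *
          G.val v none (some ({z | G.sim 1 y z}, b')) := by
    intro b' hb'
    rcases G.parentSeq_eq_none_or hpr hx with h | ⟨w, c, hwx, hwH, hw, h⟩
    · rw [h, hroot, one_mul]
    · rw [h]
      have hlen := hwx.length_le
      have hwx' : w <+: x := (List.prefix_append _ _).trans hwx
      simp only [List.length_append, List.length_singleton] at hlen
      refine ih _ (by omega) w y hw hy ?_ c b' hwH hb' rfl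
      rcases hxy with h' | h'
      · exact Or.inl (hwx'.trans h')
      · exact List.prefix_or_prefix_of_prefix hwx' h'
  have rec₂ : ∀ a', x ++ [a'] ∈ G.H →
      G.val v (some ({z | G.sim 0 x z}, a')) (G.parentSeq 1 {z | G.sim 1 y z}) =
        G.val v (some ({z | G.sim 0 x z}, a')) none *
          G.val v none (G.parentSeq 1 {z | G.sim 1 y z}) := by
    intro a' ha'
    rcases G.parentSeq_eq_none_or hpr hy with h | ⟨w, c, hwy, hwH, hw, h⟩
    · rw [h, hroot, mul_one]
    · rw [h]
      have hlen := hwy.length_le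
      have hwy' : w <+: y := (List.prefix_append _ _).trans hwy
      simp only [List.length_append, List.length_singleton] at hlen
      refine ih _ (by omega) x w hx hw ?_ a' c ha' hwH rfl
      rcases hxy with h' | h'
      · exact List.prefix_or_prefix_of_prefix h' hwy'
      · exact Or.inr (hwy'.trans h')
  have sum₁ := hsum₁ _ ⟨x, hx, rfl⟩ _ (G.isSeq_some hy hb) (Or.inr ⟨_, _, rfl, hconn⟩) x hx
  have sum₁' := hsum₁ _ ⟨x, hx, rfl⟩ none (Or.inl rfl) (Or.inl rfl) x hx
  rw [rec₁ b hb] at sum₁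
  have vanish : ∀ a', x ++ [a'] ∈ G.H → G.val v (some ({z | G.sim 0 x z}, a')) none = 0 →
      G.val v (some ({z | G.sim 0 x z}, a')) (some ({z | G.sim 1 y z}, b)) = 0 := by
    intro a' ha' h0
    have sum₂ := hsum₂ _ ⟨y, hy, rfl⟩ _ (G.isSeq_some hx ha') (Or.inr ⟨_, _, rfl, hconn⟩) y hy
    rw [rec₂ a' ha', h0, zero_mul] at sum₂
    exact (Finset.sum_eq_zero_iff_of_nonneg fun _ _ => nonneg _ _).1 sum₂ b (G.mem_actions.2 hb)
  have haA : a ∈ G.actions x := G.mem_actions.2 ha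
  rcases zero_one (some ({z | G.sim 0 x z}, a)) none with h1 | h1
  · rw [vanish a ha h1, h1, zero_mul]
  · have hpar : G.val v (G.parentSeq 0 {z | G.sim 0 x z}) none = 1 := by
      rcases zero_one (G.parentSeq 0 {z | G.sim 0 x z}) none with h | h
      · rw [h] at sum₁'
        have := (Finset.sum_eq_zero_iff_of_nonneg fun _ _ => nonneg _ _).1 sum₁' a haA
        linarith
      · exact h
    rw [← Finset.add_sum_erase _ _ haA, h1, hpar, add_eq_left,
      Finset.sum_eq_zero_iff_of_nonneg fun _ _ => nonneg _ _] at sum₁'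
    rw [Finset.sum_eq_single_of_mem a haA fun a' ha' hne =>
      vanish a' (G.mem_actions.1 ha') (sum₁' a' (Finset.mem_erase.2 ⟨hne, ha'⟩)), hpar] at sum₁
    rw [sum₁, h1]

end EFG

/-- Let `v ∈ 𝒱` have all coordinates in `{0, 1}`.  Then for every
relevant pair `(σ₁, σ₂)`, `v[σ₁, σ₂] = v[σ₁, ∅] · v[∅, σ₂]`. -/
theorem VSF_mul_of_zero_one (G : EFG) (hpr : G.PerfectRecall)
    (v : G.Idx → ℝ) (hv : v ∈ G.VSF) (hint : ∀ p : G.Idx, v p = 0 ∨ v p = 1) :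
    ∀ σ₁ σ₂ : SeqP, G.RelPair σ₁ σ₂ →
      G.val v σ₁ σ₂ = G.val v σ₁ none * G.val v none σ₂ := by
  rintro σ₁ σ₂ ⟨h₁, h₂, hrel⟩
  have hroot : G.val v none none = 1 := hv.2.1
  rcases hrel with rfl | rfl | ⟨I, a, J, b, rfl, rfl, x, hx, y, hy, hxy⟩
  · rw [hroot, one_mul]
  · rw [hroot, mul_one]
  · have class_eq : ∀ (i : Fin 2) (K : Set (List ℕ)) (c : ℕ) (z : List ℕ),
        G.IsSeq i (some (K, c)) → z ∈ K →
        G.sim i z z ∧ z ++ [c] ∈ G.H ∧ K = {w | G.sim i z w} := by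
      rintro i K c z (h | ⟨K', c', heq, ⟨t, -, rfl⟩, s, hs, hsH⟩) hz
      · cases h
      · cases heq
        have hzt := G.sim_symm _ _ _ hz
        refine ⟨G.sim_trans _ _ _ _ hzt hz,
          (G.sim_actions _ _ _ (G.sim_trans _ _ _ _ hzt hs) c).2 hsH, ?_⟩
        ext w
        exact ⟨G.sim_trans _ _ _ _ hzt, G.sim_trans _ _ _ _ hz⟩
    obtain ⟨hx', ha, rfl⟩ := class_eq 0 I a x h₁ hx
    obtain ⟨hy', hb, rfl⟩ := class_eq 1 J b y h₂ hy
    exact G.val_mul_of_zero_one_of_comparable hpr v hv hint x y hx' hy' hxy a b ha hb
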